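/- The cup product is graded commutative on cohomology: if $f\in C^n$ and $g\in C^m$ satisfy $\delta_n(f)=0$ and $\delta_m(g)=0$, then there exists $h\in C^{n+m-1}$ such that $f\smile g-(-1)^{nm}\,g\smile f=\delta_{n+m-1}(h)$. -/

import Mathlib

/-- An `S²`-cochain of degree `n` is (encoded as) a function on arrays `(ℕ → ℕ → A)` that only
depends on the triangular part of entries `(p, q)` with `1 ≤ p < q ≤ n`. -/
def IsCochain {A : Type*} (n : ℕ) (f : (ℕ → ℕ → A) → A) : Prop :=
  ∀ a b : ℕ → ℕ → A, (∀ p q : ℕ, 1 ≤ p → p < q → q ≤ n → a p q = b p q) → f a = f b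

/-- The operadic composition `f ∘ᵢ g` of an `S²`-cochain `f` of degree `n` with a cochain `g` of
degree `m` at position `1 ≤ i ≤ n`, a cochain of degree `n + m - 1`:
`(f ∘ᵢ g)(a) = f(b) · g((a_{p+i-1,q+i-1})_{1 ≤ p < q ≤ m})`, where `b` collapses the rows and
columns `i, …, i+m-1` of `a` by the operations `H` (products along rows) and `V` (products along
columns). -/
def circAt {A : Type*} [CommRing A] (f g : (ℕ → ℕ → A) → A) (m i : ℕ) :
    (ℕ → ℕ → A) → A := fun a =>
  f (fun p q =>
      if q < i then a p q
      else if p < i ∧ q = i then ∏ t ∈ Finset.Icc i (i + m - 1), a p t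
      else if p < i ∧ i < q then a p (q + m - 1)
      else if p = i ∧ i < q then ∏ t ∈ Finset.Icc i (i + m - 1), a t (q + m - 1)
      else a (p + m - 1) (q + m - 1)) *
    g (fun p q => a (p + i - 1) (q + i - 1))

/-- The cup product of `S²`-cochains `f` of degree `n` and `g` of degree `m`, a cochain of
degree `n + m`: `(f ⌣ g)(a) = (∏_{p ≤ n < q} a_{p,q}) · f((a_{p,q})_{p<q≤n}) ·
g((a_{p+n,q+n})_{p<q≤m})`. -/
def cupS2 {A : Type*} [CommRing A] (n m : ℕ) (f g : (ℕ → ℕ → A) → A) :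
    (ℕ → ℕ → A) → A := fun a =>
  (∏ p ∈ Finset.Icc 1 n, ∏ q ∈ Finset.Icc (n + 1) (n + m), a p q) *
    f a * g (fun p q => a (p + n) (q + n))

/-- The higher order Hochschild differential over `S²`: for a cochain `f` of degree `n`,
`δₙ(f)` is the cochain of degree `n + 1` given by the formula (4) of the paper. -/
def deltaS2 {A : Type*} [CommRing A] (n : ℕ) (f : (ℕ → ℕ → A) → A) :
    (ℕ → ℕ → A) → A := fun a =>
  (∏ j ∈ Finset.Icc 2 (n + 1), a 1 j) * f (fun p q => a (p + 1) (q + 1)) +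
    (∑ i ∈ Finset.Icc 1 n, (-1 : A) ^ i * (a i (i + 1) *
      f (fun p q =>
        if q < i then a p q
        else if p < i ∧ q = i then a p i * a p (i + 1)
        else if p < i ∧ i < q then a p (q + 1)
        else if p = i ∧ i < q then a i (q + 1) * a (i + 1) (q + 1)
        else a (p + 1) (q + 1)))) +
    (-1 : A) ^ (n + 1) * (∏ j ∈ Finset.Icc 1 n, a j (n + 1)) * f a


section helpers
variable {A : Type*} [CommRing A]

def PP (s : ℕ → ℕ) (a : ℕ → ℕ → A) : ℕ → ℕ → A := fun p q =>
  ∏ x ∈ Finset.Ico (s p) (s (p + 1)), ∏ y ∈ Finset.Ico (s q) (s (q + 1)), a x y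

def RR (a : ℕ → ℕ → A) (x y z : ℕ) : A :=
  ∏ u ∈ Finset.Ico x y, ∏ v ∈ Finset.Ico y z, a u v

def cc (i p : ℕ) : ℕ := if p ≤ i then p else p + 1

def ss (i m p : ℕ) : ℕ := if p ≤ i then p else p + m - 1

lemma cc_mono (i : ℕ) : Monotone (cc i) := by
  intro p q h; unfold cc; split_ifs <;> omega

lemma ss_mono (i m : ℕ) (hm : 1 ≤ m) : Monotone (ss i m) := by
  intro p q h; unfold ss; split_ifs <;> omega

lemma add_mono (i : ℕ) : Monotone (fun p : ℕ => p + i) := by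
  intro p q h; simpa using h

lemma tele (s : ℕ → ℕ) (hs : Monotone s) (F : ℕ → A) (x y : ℕ) (h : x ≤ y) :
    ∏ p ∈ Finset.Ico x y, ∏ u ∈ Finset.Ico (s p) (s (p + 1)), F u
      = ∏ u ∈ Finset.Ico (s x) (s y), F u := by
  induction y, h using Nat.le_induction with
  | base => simp
  | succ y h ih =>
    rw [Finset.prod_Ico_succ_top h, ih, Finset.prod_Ico_consecutive _ (hs h) (hs (Nat.le_succ y))]

lemma tele2 (s : ℕ → ℕ) (hs : Monotone s) (a : ℕ → ℕ → A) (x y x' y' : ℕ) (h : x ≤ y)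
    (h' : x' ≤ y') :
    ∏ p ∈ Finset.Ico x y, ∏ q ∈ Finset.Ico x' y', PP s a p q
      = ∏ u ∈ Finset.Ico (s x) (s y), ∏ v ∈ Finset.Ico (s x') (s y'), a u v := by
  rw [← tele s hs _ x y h]
  refine Finset.prod_congr rfl fun p _ => ?_
  simp only [PP]
  rw [Finset.prod_comm]
  refine Finset.prod_congr rfl fun u _ => ?_
  rw [tele s hs _ x' y' h']

lemma PP_comp (s t : ℕ → ℕ) (hs : Monotone s) (ht : Monotone t) (a : ℕ → ℕ → A) :
    PP t (PP s a) = PP (fun p => s (t p)) a := by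
  funext p q
  exact tele2 s hs a _ _ _ _ (ht (Nat.le_succ p)) (ht (Nat.le_succ q))

lemma PP_id (a : ℕ → ℕ → A) : PP (fun p => p) a = a := by
  funext p q; simp [PP]

lemma RR_PP (s : ℕ → ℕ) (hs : Monotone s) (a : ℕ → ℕ → A) (x y z : ℕ) (h : x ≤ y)
    (h' : y ≤ z) : RR (PP s a) x y z = RR a (s x) (s y) (s z) := by
  unfold RR
  exact tele2 s hs a _ _ _ _ h h'

lemma PP_congr (n : ℕ) (f : (ℕ → ℕ → A) → A) (hf : IsCochain n f) (s t : ℕ → ℕ)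
    (h : ∀ p, 1 ≤ p → p ≤ n + 1 → s p = t p) (a : ℕ → ℕ → A) : f (PP s a) = f (PP t a) := by
  apply hf
  intro p q h1 h2 h3
  simp only [PP]
  rw [h p (by omega) (by omega), h (p+1) (by omega) (by omega), h q (by omega) (by omega),
    h (q+1) (by omega) (by omega)]

lemma delta_base (n : ℕ) (f : (ℕ → ℕ → A) → A) (hf : IsCochain n f) (a : ℕ → ℕ → A) :
    deltaS2 n f a = RR a 1 2 (n + 2) * f (PP (fun p => p + 1) a)
      + ∑ i ∈ Finset.Ico 1 (n + 1), (-1 : A) ^ i * (RR a i (i+1) (i+2) * f (PP (cc i) a))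
      + (-1 : A) ^ (n + 1) * (RR a 1 (n + 1) (n + 2) * f a) := by
  unfold deltaS2
  congr 1
  · congr 1
    · congr 1
      · simp [RR]; rfl
      · congr 1; funext p q; simp [PP]
    · refine Finset.sum_congr rfl fun i hi => ?_
      congr 2
      · simp [RR]
      · apply hf
        intro p q h1 h2 h3
        have e1 : Finset.Ico i (i + 1 + 1) = {i, i+1} := by ext; simp; omega
        have e2 : ∀ k, i + (k + 1) + 1 = i + (k+2) := by intro k; ring
        rcases lt_trichotomy p i with hp | hp | hp <;> rcases lt_trichotomy q i with hq | hq | hq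
        · simp [PP, cc, hp.le, hq.le, hq, show p + 1 ≤ i by omega, show q + 1 ≤ i by omega]
        · subst hq
          simp [PP, cc, hp.le, hp, show p + 1 ≤ q by omega, e1]
        · simp [PP, cc, hp, hp.le, hq, show p + 1 ≤ i by omega, show ¬ q ≤ i by omega,
            show ¬ q < i by omega, show ¬ q + 1 ≤ i by omega, show q ≠ i by omega]
        · omega
        · omega
        · subst hp
          simp [PP, cc, hq, show ¬ q ≤ p by omega, e1,
            show ¬ q < p by omega, show ¬ q + 1 ≤ p by omega]
        · omega
        · omega
        · simp [PP, cc, hq, show ¬ q ≤ i by omega, show ¬ p < i by omega, show p ≠ i by omega,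
            show ¬ q < i by omega, show ¬ q + 1 ≤ i by omega,
            show ¬ p ≤ i by omega, show ¬ p + 1 ≤ i by omega]
  · rw [mul_assoc]
    congr 2
    simp [RR]; rfl

lemma delta_PP (n : ℕ) (f : (ℕ → ℕ → A) → A) (hf : IsCochain n f) (s : ℕ → ℕ) (hs : Monotone s)
    (a : ℕ → ℕ → A) :
    deltaS2 n f (PP s a) = RR a (s 1) (s 2) (s (n + 2)) * f (PP (fun p => s (p + 1)) a)
      + ∑ i ∈ Finset.Ico 1 (n + 1), (-1 : A) ^ i *
          (RR a (s i) (s (i+1)) (s (i+2)) * f (PP (fun p => s (cc i p)) a))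
      + (-1 : A) ^ (n + 1) * (RR a (s 1) (s (n + 1)) (s (n + 2)) * f (PP s a)) := by
  rw [delta_base n f hf, RR_PP s hs a 1 2 (n+2) (by omega) (by omega),
    RR_PP s hs a 1 (n+1) (n+2) (by omega) (by omega), PP_comp s _ hs (add_mono 1)]
  congr 2
  refine Finset.sum_congr rfl fun i _ => ?_
  rw [RR_PP s hs a i (i+1) (i+2) (by omega) (by omega), PP_comp s _ hs (cc_mono i)]

/-- composition at position `i+1` -/
def DD (f g : (ℕ → ℕ → A) → A) (m i : ℕ) : (ℕ → ℕ → A) → A := fun a =>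
  f (PP (ss (i+1) m) a) * g (PP (fun p => p + i) a)

lemma DD_cochain (f g : (ℕ → ℕ → A) → A) (n m i : ℕ) (hm : 1 ≤ m) (hi : i < n)
    (hf : IsCochain n f) (hg : IsCochain m g) : IsCochain (n + m - 1) (DD f g m i) := by
  intro a b h
  unfold DD
  congr 1
  · apply hf
    intro p q h1 h2 h3
    refine Finset.prod_congr rfl fun x hx => Finset.prod_congr rfl fun y hy => ?_
    simp only [Finset.mem_Ico, ss] at hx hy
    apply h <;> split_ifs at hx hy <;> omega
  · apply hg
    intro p q h1 h2 h3
    refine Finset.prod_congr rfl fun x hx => Finset.prod_congr rfl fun y hy => ?_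
    simp only [Finset.mem_Ico] at hx hy
    apply h <;> omega

def XX (f g : (ℕ → ℕ → A) → A) (m : ℕ) (a : ℕ → ℕ → A) (k i : ℕ) : A :=
  RR a (ss i m k) (ss i m (k+1)) (ss i m (k+2)) * f (PP (fun p => ss i m (cc k p)) a) *
    g (PP (fun p => p + (i - 1)) a)

def T2 (f g : (ℕ → ℕ → A) → A) (n m : ℕ) (a : ℕ → ℕ → A) (i : ℕ) : A :=
  RR a (ss (i+1) m 1) (ss (i+1) m 2) (ss (i+1) m (n+2)) *
    f (PP (fun p => ss (i+1) m (p + 1)) a) * g (PP (fun p => p + i) a)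

def T1 (f g : (ℕ → ℕ → A) → A) (n m : ℕ) (a : ℕ → ℕ → A) (i : ℕ) : A :=
  RR a (ss i m 1) (ss i m (n+1)) (ss i m (n+2)) *
    f (PP (ss i m) a) * g (PP (fun p => p + (i - 1)) a)

lemma f_cocycle (f g : (ℕ → ℕ → A) → A) (n m : ℕ) (hm : 1 ≤ m) (hf : IsCochain n f)
    (hfc : ∀ a : ℕ → ℕ → A, deltaS2 n f a = 0) (a : ℕ → ℕ → A) (i : ℕ) :
    ∑ k ∈ Finset.Ico 1 (n+1), (-1 : A) ^ k * XX f g m a k (i+1)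
      = - T2 f g n m a i + (-1) ^ n * T1 f g n m a (i+1) := by
  have h := hfc (PP (ss (i+1) m) a)
  rw [delta_PP n f hf _ (ss_mono _ _ hm)] at h
  have h2 : ∑ k ∈ Finset.Ico 1 (n+1), (-1 : A) ^ k * XX f g m a k (i+1) =
    (∑ k ∈ Finset.Ico 1 (n + 1), (-1 : A) ^ k *
          (RR a (ss (i+1) m k) (ss (i+1) m (k+1)) (ss (i+1) m (k+2)) *
            f (PP (fun p => ss (i+1) m (cc k p)) a))) * g (PP (fun p => p + i) a) := by
    rw [Finset.sum_mul]
    refine Finset.sum_congr rfl fun k _ => ?_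
    simp only [XX, Nat.add_sub_cancel]; ring
  rw [h2]
  simp only [T2, T1, Nat.add_sub_cancel]
  linear_combination g (PP (fun p => p + i) a) * h

lemma delta_DD (f g : (ℕ → ℕ → A) → A) (n m : ℕ) (hm : 1 ≤ m) (hf : IsCochain n f)
    (hg : IsCochain m g) (hgc : ∀ a : ℕ → ℕ → A, deltaS2 m g a = 0) (a : ℕ → ℕ → A) (i : ℕ)
    (hi : i < n) :
    deltaS2 (n + m - 1) (DD f g m i) a = T2 f g n m a (i+1) + (-1) ^ (n + m) * T1 f g n m a (i+1)
      + ∑ k ∈ Finset.Ico 1 (i+2), (-1 : A) ^ k * XX f g m a k (i+2)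
      + (-1) ^ (m+1) * ∑ k ∈ Finset.Ico (i+1) (n+1), (-1 : A) ^ k * XX f g m a k (i+1) := by
  rw [delta_base _ _ (DD_cochain f g n m i hm hi hf hg)]
  have hN : n + m - 1 + 1 = n + m := by omega
  have hN2 : n + m - 1 + 2 = n + m + 1 := by omega
  rw [hN, hN2]
  -- outer terms
  have e2 : RR a 1 2 (n + m + 1) * DD f g m i (PP (fun p => p + 1) a) = T2 f g n m a (i+1) := by
    unfold DD T2
    rw [PP_comp _ _ (add_mono 1) (ss_mono _ _ hm), PP_comp _ _ (add_mono 1) (add_mono i), ← mul_assoc]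
    congr 1
    · congr 1
      · congr 1 <;> simp only [ss] <;> split_ifs <;> omega
      · apply PP_congr n f hf
        intro p _ _
        simp only [ss]; split_ifs <;> omega
  have e1 : RR a 1 (n + m) (n + m + 1) * DD f g m i a = T1 f g n m a (i+1) := by
    unfold DD T1
    rw [← mul_assoc, Nat.add_sub_cancel]
    congr 2
    congr 1 <;> simp only [ss] <;> split_ifs <;> omega
  rw [e2, e1]
  -- split the sum
  rw [← Finset.sum_Ico_consecutive _ (show 1 ≤ i + 1 by omega) (show i + 1 ≤ n + m by omega),
    ← Finset.sum_Ico_consecutive _ (show i + 1 ≤ i + 1 + m by omega)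
      (show i + 1 + m ≤ n + m by omega)]
  have s1 : ∑ k ∈ Finset.Ico 1 (i+1), (-1 : A) ^ k *
      (RR a k (k+1) (k+2) * DD f g m i (PP (cc k) a)) =
      ∑ k ∈ Finset.Ico 1 (i+1), (-1 : A) ^ k * XX f g m a k (i+2) := by
    refine Finset.sum_congr rfl fun k hk => ?_
    simp only [Finset.mem_Ico] at hk
    congr 1
    unfold DD XX
    rw [PP_comp _ _ (cc_mono k) (ss_mono _ _ hm), PP_comp _ _ (cc_mono k) (add_mono i), ← mul_assoc]
    congr 1
    · congr 1
      · congr 1 <;> simp only [ss] <;> split_ifs <;> omega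
      · apply PP_congr n f hf
        intro p _ _
        simp only [ss, cc]; split_ifs <;> omega
    · apply PP_congr m g hg
      intro p _ _
      simp only [cc]; split_ifs <;> omega
  have s3 : ∑ k ∈ Finset.Ico (i+1+m) (n+m), (-1 : A) ^ k *
      (RR a k (k+1) (k+2) * DD f g m i (PP (cc k) a)) =
      (-1) ^ (m+1) * ∑ k ∈ Finset.Ico (i+2) (n+1), (-1 : A) ^ k * XX f g m a k (i+1) := by
    rw [show i + 1 + m = (i + 2) + (m - 1) by omega, show n + m = (n + 1) + (m - 1) by omega,
      ← Finset.sum_Ico_add', Finset.mul_sum]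
    refine Finset.sum_congr rfl fun k hk => ?_
    simp only [Finset.mem_Ico] at hk
    rw [← mul_assoc ((-1 : A) ^ (m+1)), ← pow_add]
    congr 1
    · rw [show m + 1 + k = k + (m - 1) + 2 by omega, pow_add _ _ 2]; simp
    unfold DD XX
    rw [PP_comp _ _ (cc_mono _) (ss_mono _ _ hm), PP_comp _ _ (cc_mono _) (add_mono i), ← mul_assoc]
    congr 1
    · congr 1
      · congr 1 <;> simp only [ss] <;> split_ifs <;> omega
      · apply PP_congr n f hf
        intro p _ _
        simp only [ss, cc]; split_ifs <;> omega
    · apply PP_congr m g hg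
      intro p _ _
      simp only [cc]; split_ifs <;> omega
  have s2 : ∑ k ∈ Finset.Ico (i+1) (i+1+m), (-1 : A) ^ k *
      (RR a k (k+1) (k+2) * DD f g m i (PP (cc k) a)) =
      (-1) ^ (i+1) * XX f g m a (i+1) (i+2) +
        (-1) ^ (m+1) * ((-1) ^ (i+1) * XX f g m a (i+1) (i+1)) := by
    have h := hgc (PP (fun p => p + i) a)
    rw [delta_PP m g hg _ (add_mono i)] at h
    rw [show i + 1 = 1 + i by omega, show 1 + i + m = (m + 1) + i by omega,
      ← Finset.sum_Ico_add']
    have hs : ∑ k ∈ Finset.Ico 1 (m+1), (-1 : A) ^ (k + i) *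
      (RR a (k+i) (k+i+1) (k+i+2) * DD f g m i (PP (cc (k+i)) a)) =
      (-1) ^ i * f (PP (ss (i+1) (m+1)) a) * ∑ k ∈ Finset.Ico 1 (m+1), (-1 : A) ^ k *
          (RR a (k + i) (k + 1 + i) (k + 2 + i) * g (PP (fun p => cc k p + i) a)) := by
      rw [Finset.mul_sum]
      refine Finset.sum_congr rfl fun k hk => ?_
      simp only [Finset.mem_Ico] at hk
      unfold DD
      rw [PP_comp _ _ (cc_mono _) (ss_mono _ _ hm), PP_comp _ _ (cc_mono _) (add_mono i)]
      have x1 : f (PP (fun p => cc (k+i) (ss (i+1) m p)) a) = f (PP (ss (i+1) (m+1)) a) := by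
        apply PP_congr n f hf
        intro p _ _
        simp only [ss, cc]; split_ifs <;> omega
      have x2 : g (PP (fun p => cc (k+i) (p + i)) a) = g (PP (fun p => cc k p + i) a) := by
        apply PP_congr m g hg
        intro p _ _
        simp only [cc]; split_ifs <;> omega
      rw [x1, x2, show k + i + 1 = k + 1 + i by omega, show k + i + 2 = k + 2 + i by omega]
      ring
    rw [hs]
    have y1 : XX f g m a (1+i) (i+2) = f (PP (ss (i+1) (m+1)) a) *
        (RR a (1+i) (2+i) (m+2+i) * g (PP (fun p => p + 1 + i) a)) := by
      unfold XX
      have x1 : f (PP (fun p => ss (i+2) m (cc (1+i) p)) a) = f (PP (ss (i+1) (m+1)) a) := by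
        apply PP_congr n f hf
        intro p _ _
        simp only [ss, cc]; split_ifs <;> omega
      have x2 : g (PP (fun p => p + (i + 2 - 1)) a) = g (PP (fun p => p + 1 + i) a) := by
        apply PP_congr m g hg
        intro p _ _
        omega
      have z1 : ss (i+2) m (1+i) = 1 + i := by simp only [ss]; split_ifs <;> omega
      have z2 : ss (i+2) m (1+i+1) = 2 + i := by simp only [ss]; split_ifs <;> omega
      have z3 : ss (i+2) m (1+i+2) = m+2+i := by simp only [ss]; split_ifs <;> omega
      rw [x1, x2, z1, z2, z3]; ring
    have y2 : XX f g m a (1+i) (1+i) = f (PP (ss (i+1) (m+1)) a) *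
        (RR a (1+i) (m+1+i) (m+2+i) * g (PP (fun p => p + i) a)) := by
      unfold XX
      have x1 : f (PP (fun p => ss (1+i) m (cc (1+i) p)) a) = f (PP (ss (i+1) (m+1)) a) := by
        apply PP_congr n f hf
        intro p _ _
        simp only [ss, cc]; split_ifs <;> omega
      have x2 : g (PP (fun p => p + (1 + i - 1)) a) = g (PP (fun p => p + i) a) := by
        apply PP_congr m g hg
        intro p _ _
        omega
      have z1 : ss (1+i) m (1+i) = 1 + i := by simp only [ss]; split_ifs <;> omega
      have z2 : ss (1+i) m (1+i+1) = m+1 + i := by simp only [ss]; split_ifs <;> omega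
      have z3 : ss (1+i) m (1+i+2) = m+2+i := by simp only [ss]; split_ifs <;> omega
      rw [x1, x2, z1, z2, z3]; ring
    rw [y1, y2]
    linear_combination (-1) ^ i * f (PP (ss (i+1) (m+1)) a) * h
  rw [s1, s2, s3, Finset.sum_Ico_succ_top (show 1 ≤ i + 1 by omega),
    Finset.sum_eq_sum_Ico_succ_bot (show i + 1 < n + 1 by omega)]
  ring

lemma alg (n : ℕ) (e s : A) (he : e * e = 1) (T L U T' : ℕ → A)
    (h : ∀ i, L (i+1) + U (i+1) = - T i + s * T' (i+1)) (h0 : L 1 = 0) :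
    ∑ i ∈ Finset.range n, e ^ i * (T (i+1) + (- s * e) * T' (i+1) + L (i+2) + e * U (i+1)) =
      e ^ (n+1) * (L (n+1) + T n) - e * T 0 := by
  induction n with
  | zero => simp [h0]
  | succ j ih =>
    rw [Finset.sum_range_succ, ih]
    have := h j
    linear_combination e ^ (j+1) * this - e ^ j * (L (j+2) + T (j+1)) * he

lemma delta_lin (N n : ℕ) (c : ℕ → A) (D : ℕ → (ℕ → ℕ → A) → A) (a : ℕ → ℕ → A) :
    deltaS2 N (fun a => ∑ i ∈ Finset.range n, c i * D i a) a
      = ∑ i ∈ Finset.range n, c i * deltaS2 N (D i) a := by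
  unfold deltaS2
  simp only [mul_add, Finset.sum_add_distrib, Finset.mul_sum]
  congr 1
  · congr 1
    · refine Finset.sum_congr rfl fun i _ => ?_
      ring
    · rw [Finset.sum_comm]
      refine Finset.sum_congr rfl fun i _ => Finset.sum_congr rfl fun k _ => ?_
      ring
  · refine Finset.sum_congr rfl fun i _ => ?_
    ring

end helpers

/-- the cup product is graded commutative on cohomology: for cocycles `f ∈ Cⁿ`
and `g ∈ Cᵐ`, the difference `f ⌣ g - (-1)^{nm} g ⌣ f` is a coboundary `δ_{n+m-1}(h)` for some
`h ∈ C^{n+m-1}`. -/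
theorem cupS2_graded_comm_on_cohomology {A : Type*} [CommRing A]
    (n m : ℕ) (hn : 1 ≤ n) (hm : 1 ≤ m)
    (f g : (ℕ → ℕ → A) → A) (hf : IsCochain n f) (hg : IsCochain m g)
    (hfc : ∀ a : ℕ → ℕ → A, deltaS2 n f a = 0) (hgc : ∀ a : ℕ → ℕ → A, deltaS2 m g a = 0) :
    ∃ h : (ℕ → ℕ → A) → A, IsCochain (n + m - 1) h ∧
      ∀ a : ℕ → ℕ → A,
        cupS2 n m f g a - (-1 : A) ^ (n * m) * cupS2 m n g f a = deltaS2 (n + m - 1) h a := by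
  refine ⟨fun a => ∑ i ∈ Finset.range n, ((-1) ^ (n*m) * (-1) ^ (m+1) * ((-1) ^ (m+1)) ^ i) *
    DD f g m i a, ?_, ?_⟩
  · intro a b hab
    refine Finset.sum_congr rfl fun i hi => ?_
    rw [DD_cochain f g n m i hm (Finset.mem_range.1 hi) hf hg a b hab]
  intro a
  rw [delta_lin]
  have he : ((-1 : A) ^ (m+1)) * (-1) ^ (m+1) = 1 := by
    rw [← mul_pow]; simp
  have hk := alg n ((-1 : A) ^ (m+1)) ((-1) ^ n) he (T2 f g n m a)
    (fun i => ∑ k ∈ Finset.Ico 1 (min i (n+1)), (-1 : A) ^ k * XX f g m a k i)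
    (fun i => ∑ k ∈ Finset.Ico (min i (n+1)) (n+1), (-1 : A) ^ k * XX f g m a k i)
    (T1 f g n m a)
    (fun i => by
      rw [Finset.sum_Ico_consecutive _ (by omega) (by omega)]
      exact f_cocycle f g n m hm hf hfc a i) (by simp)
  have hl := f_cocycle f g n m hm hf hfc a n
  have hfg : T1 f g n m a (n+1) = cupS2 n m f g a := by
    unfold T1 cupS2
    congr 1
    · congr 1
      · have z1 : ss (n+1) m 1 = 1 := by simp only [ss]; split_ifs <;> omega
        have z2 : ss (n+1) m (n+1) = n+1 := by simp only [ss]; split_ifs <;> omega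
        have z3 : ss (n+1) m (n+2) = n+m+1 := by simp only [ss]; split_ifs <;> omega
        rw [z1, z2, z3]; rfl
      · conv_rhs => rw [← PP_id a]
        apply PP_congr n f hf
        intro p _ _
        simp only [ss]; split_ifs <;> omega
    · congr 1; funext p q; simp [PP, Nat.add_right_comm _ 1]
  have hgf : T2 f g n m a 0 = cupS2 m n g f a := by
    unfold T2 cupS2
    rw [mul_right_comm]
    congr 1
    · congr 1
      · have z1 : ss (0+1) m 1 = 1 := by simp only [ss]; split_ifs <;> omega
        have z2 : ss (0+1) m 2 = m+1 := by simp only [ss]; split_ifs <;> omega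
        have z3 : ss (0+1) m (n+2) = m+n+1 := by simp only [ss]; split_ifs <;> omega
        rw [z1, z2, z3]; rfl
      · simp [PP_id]
    · have : (fun p q => a (p + m) (q + m)) = PP (fun p => p + m) a := by
        funext p q; simp [PP, Nat.add_right_comm _ 1]
      rw [this]
      apply PP_congr n f hf
      intro p _ _
      simp only [ss]; split_ifs <;> omega
  have hsum : ∑ i ∈ Finset.range n, ((-1 : A) ^ (n*m) * (-1) ^ (m+1) * ((-1) ^ (m+1)) ^ i) *
      deltaS2 (n + m - 1) (DD f g m i) a =
      (-1) ^ (n*m) * (-1) ^ (m+1) * (((-1) ^ (m+1)) ^ (n+1) * ((-1) ^ n * cupS2 n m f g a)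
        - (-1) ^ (m+1) * cupS2 m n g f a) := by
    have hk' : ((-1 : A) ^ (m+1)) ^ (n+1) * ((-1) ^ n * cupS2 n m f g a)
        - (-1) ^ (m+1) * cupS2 m n g f a = ((-1 : A) ^ (m+1)) ^ (n+1) *
          ((∑ k ∈ Finset.Ico 1 (min (n+1) (n+1)), (-1 : A) ^ k * XX f g m a k (n+1))
            + T2 f g n m a n) - (-1) ^ (m+1) * T2 f g n m a 0 := by
      rw [← hfg, ← hgf, min_self, hl]; ring
    rw [hk', ← hk, Finset.mul_sum]
    refine Finset.sum_congr rfl fun i hi => ?_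
    have hi' := Finset.mem_range.1 hi
    rw [delta_DD f g n m hm hf hg hgc a i hi', min_eq_left (show i + 2 ≤ n + 1 by omega),
      min_eq_left (show i + 1 ≤ n + 1 by omega)]
    ring
  rw [hsum]
  have hp : ((-1 : A) ^ (m+1)) ^ (n+1) * (-1) ^ n = (-1) ^ (m+1) * (-1) ^ (n*m) := by
    have h2 : (-1 : A) ^ n * (-1) ^ n = 1 := by rw [← mul_pow]; simp
    have : ((-1 : A) ^ (m+1)) ^ (n+1) = (-1) ^ (m+1) * ((-1) ^ (n*m) * (-1) ^ n) := by
      rw [← pow_mul, ← pow_add, ← pow_add]; congr 1; ring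
    rw [this]; linear_combination (-1) ^ (m+1) * (-1) ^ (n*m) * h2
  have hq : (-1 : A) ^ (n*m) * (-1) ^ (n*m) = 1 := by rw [← mul_pow]; simp
  generalize (-1 : A) ^ (n*m) = u at *
  generalize cupS2 n m f g a = x at *
  generalize cupS2 m n g f a = y at *
  generalize (-1 : A) ^ (m+1) = e at *
  linear_combination (- u * e * x) * hp + (- e * e * x) * hq + (-x + u * y) * he
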